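/- arXiv:1906.04827 — 10 statements merged into one kernel-verified Lean document; each statement's English description precedes it below -/
import Mathlib

section
/- Let l₁, l₂, w₁, w₂ be positive real numbers and G a nonnegative integer. Define for b > 0: N(b) = l₁w₁b² + 2l₂(1−G)b + l₁w₂, H(b) = N(b)³/(b²(w₁b+w₂)²), and F(b) = l₁w₁²b³ + (Gl₂w₁ + 2l₁w₁w₂ − l₂w₁)b² − (Gl₂w₂ + 2l₁w₁w₂ − l₂w₂)b − l₁w₂². Then for every b > 0, H′(b) = 0 if and only if N(b) = 0 or F(b) = 0 (equivalently, H(b) = 0 or F(b) = 0). -/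
/-- The derivative of `N ^ 3 / q ^ 2` for `N = l₁ w₁ b² + 2 c b + l₁ w₂` and `q = b (w₁ b + w₂)` is
`2 N² F / q ^ 3` for an explicit cubic `F`. -/
theorem hasDerivAt_cube_div_sq (l₁ w₁ w₂ c b : ℝ) (hb : b ≠ 0) (hq : w₁ * b + w₂ ≠ 0) :
    HasDerivAt
      (fun x => (l₁ * w₁ * x ^ 2 + 2 * c * x + l₁ * w₂) ^ 3 / (x ^ 2 * (w₁ * x + w₂) ^ 2))
      (2 * (l₁ * w₁ * b ^ 2 + 2 * c * b + l₁ * w₂) ^ 2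
        * (l₁ * w₁ ^ 2 * b ^ 3 + (2 * l₁ * w₁ * w₂ - c * w₁) * b ^ 2
          - (2 * l₁ * w₁ * w₂ - c * w₂) * b - l₁ * w₂ ^ 2)
        / (b * (w₁ * b + w₂)) ^ 3) b := by
  have hx := hasDerivAt_id' b
  have hN := ((((hx.fun_pow 2).const_mul (l₁ * w₁)).fun_add
    (hx.const_mul (2 * c))).add_const (l₁ * w₂)).fun_pow 3
  have hD := (hx.fun_pow 2).fun_mul (((hx.const_mul w₁).add_const w₂).fun_pow 2)
  refine (hN.fun_div hD (by positivity)).congr_deriv ?_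
  field_simp
  push_cast
  ring

/-- With `N`, `H`, `F` as in the previous statement, for every `b > 0`,
`H′(b) = 0` iff `N(b) = 0` or `F(b) = 0` (equivalently, `H(b) = 0` or `F(b) = 0`). -/
theorem stmt_1 (l₁ l₂ w₁ w₂ : ℝ) (hl₁ : 0 < l₁) (hl₂ : 0 < l₂)
    (hw₁ : 0 < w₁) (hw₂ : 0 < w₂) (G : ℕ)
    (N H F : ℝ → ℝ)
    (hN : ∀ b, N b = l₁ * w₁ * b ^ 2 + 2 * l₂ * (1 - (G : ℝ)) * b + l₁ * w₂)
    (hH : ∀ b, H b = (N b) ^ 3 / (b ^ 2 * (w₁ * b + w₂) ^ 2))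
    (hF : ∀ b, F b = l₁ * w₁ ^ 2 * b ^ 3
        + ((G : ℝ) * l₂ * w₁ + 2 * l₁ * w₁ * w₂ - l₂ * w₁) * b ^ 2
        - ((G : ℝ) * l₂ * w₂ + 2 * l₁ * w₁ * w₂ - l₂ * w₂) * b - l₁ * w₂ ^ 2) :
    ∀ b : ℝ, 0 < b →
      ((deriv H b = 0 ↔ (N b = 0 ∨ F b = 0)) ∧
       (deriv H b = 0 ↔ (H b = 0 ∨ F b = 0))) := by
  intro b hb
  have hq : w₁ * b + w₂ ≠ 0 := by positivity
  have hHfun : H = fun x => (l₁ * w₁ * x ^ 2 + 2 * (l₂ * (1 - (G : ℝ))) * x + l₁ * w₂) ^ 3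
      / (x ^ 2 * (w₁ * x + w₂) ^ 2) := by
    funext x
    rw [hH, hN, mul_assoc 2 l₂]
  have hderiv : deriv H b = 2 * N b ^ 2 * F b / (b * (w₁ * b + w₂)) ^ 3 := by
    rw [hHfun, (hasDerivAt_cube_div_sq l₁ w₁ w₂ (l₂ * (1 - (G : ℝ))) b hb.ne' hq).deriv, hN, hF]
    ring
  have hHzero : H b = 0 ↔ N b = 0 := by simp [hH, hb.ne', hq]
  have hcrit : deriv H b = 0 ↔ (N b = 0 ∨ F b = 0) := by simp [hderiv, hb.ne', hq]
  exact ⟨hcrit, by rw [hHzero, hcrit]⟩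
end

section
/- Let l₁, l₂, w₁, w₂ be positive real numbers and G a nonnegative integer. Define for b > 0 the polynomials F(b) = l₁w₁²b³ + (Gl₂w₁ + 2l₁w₁w₂ − l₂w₁)b² − (Gl₂w₂ + 2l₁w₁w₂ − l₂w₂)b − l₁w₂², g₁(b) = l₁²w₁³b⁵ + 3l₁²w₁²w₂b⁴ + 2w₁(l₂²(G−1)² + 2(1−G)l₁l₂w₂ − l₁²w₁w₂)b³ + 2w₂(l₂²(G−1)² + 2(1−G)l₁l₂w₁ − l₁²w₁w₂)b² + 3l₁²w₁w₂²b + l₁²w₂³, g₂(b) = l₁w₁⁴b⁵ + ((1−G)l₂w₁³ + 7l₁w₁³w₂)b⁴ + (2(1−G)l₂w₁²w₂ + 3l₁w₁³w₂ + 10l₁w₁²w₂²)b³ + (2(1−G)l₂w₁w₂² + 10l₁w₁²w₂² + 3l₁w₁w₂³)b² + ((1−G)l₂w₂³ + 7l₁w₁w₂³)b + l₁w₂⁴, and the rational function SE(b) = g₁(b)³/(b⁴(w₁b+w₂)(w₁²b²+4w₁w₂b+w₂²)³). Then for every b > 0, SE′(b) = 4·F(b)·g₁(b)²·g₂(b)/(b⁵(w₁b+w₂)²(w₁²b²+4w₁w₂b+w₂²)⁴).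 -/
/-- The derivative of `g³ / (x⁴ p q³)` over the common denominator `b⁵ p² q⁴`. -/
theorem hasDerivAt_cube_div_pow_mul {g p q : ℝ → ℝ} {g' p' q' b : ℝ}
    (hg : HasDerivAt g g' b) (hp : HasDerivAt p p' b) (hq : HasDerivAt q q' b)
    (hb : b ≠ 0) (hpb : p b ≠ 0) (hqb : q b ≠ 0) :
    HasDerivAt (fun x => g x ^ 3 / (x ^ 4 * p x * q x ^ 3))
      (g b ^ 2 * (3 * g' * b * p b * q b
          - g b * (4 * p b * q b + b * p' * q b + 3 * b * p b * q')) /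
        (b ^ 5 * p b ^ 2 * q b ^ 4)) b := by
  have hden : b ^ 4 * p b * q b ^ 3 ≠ 0 := by positivity
  refine ((hg.fun_pow 3).fun_div
    (((hasDerivAt_pow 4 b).fun_mul hp).fun_mul (hq.fun_pow 3)) hden).congr_deriv ?_
  push_cast
  field_simp

/-- The derivative of a real quintic given by its coefficients. -/
theorem hasDerivAt_quintic {f : ℝ → ℝ} {a₅ a₄ a₃ a₂ a₁ a₀ : ℝ}
    (hf : ∀ x, f x = a₅ * x ^ 5 + a₄ * x ^ 4 + a₃ * x ^ 3 + a₂ * x ^ 2 + a₁ * x + a₀) (b : ℝ) :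
    HasDerivAt f (5 * a₅ * b ^ 4 + 4 * a₄ * b ^ 3 + 3 * a₃ * b ^ 2 + 2 * a₂ * b + a₁) b := by
  rw [funext hf]
  have h := ((((((hasDerivAt_pow 5 b).const_mul a₅).fun_add
    ((hasDerivAt_pow 4 b).const_mul a₄)).fun_add ((hasDerivAt_pow 3 b).const_mul a₃)).fun_add
    ((hasDerivAt_pow 2 b).const_mul a₂)).fun_add ((hasDerivAt_id' b).const_mul a₁)).add_const a₀
  refine h.congr_deriv ?_
  push_cast
  ring

/-- Derivative formula for the Sasaki energy functional
`SE(b) = g₁(b)³/(b⁴(w₁b+w₂)(w₁²b²+4w₁w₂b+w₂²)³)`: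
`SE′(b) = 4·F(b)·g₁(b)²·g₂(b)/(b⁵(w₁b+w₂)²(w₁²b²+4w₁w₂b+w₂²)⁴)` for `b > 0`. -/
theorem stmt_2 (l₁ l₂ w₁ w₂ : ℝ) (hl₁ : 0 < l₁) (hl₂ : 0 < l₂)
    (hw₁ : 0 < w₁) (hw₂ : 0 < w₂) (G : ℕ)
    (F g₁ g₂ SE : ℝ → ℝ)
    (hF : ∀ b, F b = l₁ * w₁ ^ 2 * b ^ 3
        + ((G : ℝ) * l₂ * w₁ + 2 * l₁ * w₁ * w₂ - l₂ * w₁) * b ^ 2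
        - ((G : ℝ) * l₂ * w₂ + 2 * l₁ * w₁ * w₂ - l₂ * w₂) * b - l₁ * w₂ ^ 2)
    (hg₁ : ∀ b, g₁ b = l₁ ^ 2 * w₁ ^ 3 * b ^ 5 + 3 * l₁ ^ 2 * w₁ ^ 2 * w₂ * b ^ 4
        + 2 * w₁ * (l₂ ^ 2 * ((G : ℝ) - 1) ^ 2 + 2 * (1 - (G : ℝ)) * l₁ * l₂ * w₂
            - l₁ ^ 2 * w₁ * w₂) * b ^ 3
        + 2 * w₂ * (l₂ ^ 2 * ((G : ℝ) - 1) ^ 2 + 2 * (1 - (G : ℝ)) * l₁ * l₂ * w₁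
            - l₁ ^ 2 * w₁ * w₂) * b ^ 2
        + 3 * l₁ ^ 2 * w₁ * w₂ ^ 2 * b + l₁ ^ 2 * w₂ ^ 3)
    (hg₂ : ∀ b, g₂ b = l₁ * w₁ ^ 4 * b ^ 5
        + ((1 - (G : ℝ)) * l₂ * w₁ ^ 3 + 7 * l₁ * w₁ ^ 3 * w₂) * b ^ 4
        + (2 * (1 - (G : ℝ)) * l₂ * w₁ ^ 2 * w₂ + 3 * l₁ * w₁ ^ 3 * w₂
            + 10 * l₁ * w₁ ^ 2 * w₂ ^ 2) * b ^ 3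
        + (2 * (1 - (G : ℝ)) * l₂ * w₁ * w₂ ^ 2 + 10 * l₁ * w₁ ^ 2 * w₂ ^ 2
            + 3 * l₁ * w₁ * w₂ ^ 3) * b ^ 2
        + ((1 - (G : ℝ)) * l₂ * w₂ ^ 3 + 7 * l₁ * w₁ * w₂ ^ 3) * b + l₁ * w₂ ^ 4)
    (hSE : ∀ b, SE b = (g₁ b) ^ 3 /
        (b ^ 4 * (w₁ * b + w₂) * (w₁ ^ 2 * b ^ 2 + 4 * w₁ * w₂ * b + w₂ ^ 2) ^ 3)) :
    ∀ b : ℝ, 0 < b →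
      deriv SE b = 4 * F b * (g₁ b) ^ 2 * g₂ b /
        (b ^ 5 * (w₁ * b + w₂) ^ 2 * (w₁ ^ 2 * b ^ 2 + 4 * w₁ * w₂ * b + w₂ ^ 2) ^ 4) := by
  intro b hb
  have hg := hasDerivAt_quintic hg₁ b
  have hp : HasDerivAt (fun x => w₁ * x + w₂) w₁ b := by
    simpa using ((hasDerivAt_id' b).const_mul w₁).add_const w₂
  have hq : HasDerivAt (fun x => w₁ ^ 2 * x ^ 2 + 4 * w₁ * w₂ * x + w₂ ^ 2)
      (2 * w₁ ^ 2 * b + 4 * w₁ * w₂) b := by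
    refine (hasDerivAt_quintic (a₅ := 0) (a₄ := 0) (a₃ := 0) (a₂ := w₁ ^ 2)
      (a₁ := 4 * w₁ * w₂) (a₀ := w₂ ^ 2) (fun x => ?_) b).congr_deriv ?_ <;> ring
  rw [funext hSE, (hasDerivAt_cube_div_pow_mul hg hp hq hb.ne' (by positivity)
    (by positivity)).deriv, mul_right_comm (4 * F b), mul_comm (4 * F b * g₂ b)]
  congr 2
  rw [hF, hg₁, hg₂]
  ring
end

section
/- Let G ∈ {0,1,2,3} and define H(b) = (3b² − 2(G−1)b + 2)³/(b²(3b+2)²) for b > 0. Then there is exactly one b₀ ∈ (0,∞) with H′(b₀) = 0, and H attains its global minimum on (0,∞) at b₀. -/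
/-- The Einstein–Hilbert quotient has derivative `2 N² p / (b³ (3b + 2)³)` for a cubic `p`. -/
lemma hasDerivAt_quotient (g b : ℝ) (hb : 0 < b) :
    HasDerivAt (fun b : ℝ => (3 * b ^ 2 - 2 * g * b + 2) ^ 3 / (b ^ 2 * (3 * b + 2) ^ 2))
      (2 * (3 * b ^ 2 - 2 * g * b + 2) ^ 2 / (b ^ 3 * (3 * b + 2) ^ 3) *
        (9 * b ^ 3 + (12 + 3 * g) * b ^ 2 - (2 * g + 12) * b - 4)) b := by
  have hid := hasDerivAt_id' b
  have hnum : HasDerivAt (fun b : ℝ => (3 * b ^ 2 - 2 * g * b + 2) ^ 3) _ b :=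
    ((((hid.pow 2).const_mul 3).sub (hid.const_mul (2 * g))).add_const 2).pow 3
  have hden : HasDerivAt (fun b : ℝ => b ^ 2 * (3 * b + 2) ^ 2) _ b :=
    (hid.pow 2).mul (((hid.const_mul 3).add_const 2).pow 2)
  have h2 : 3 * b + 2 ≠ 0 := by positivity
  refine (hnum.div hden (by positivity)).congr_deriv ?_
  simp only [Pi.sub_apply, Pi.pow_apply]
  field_simp
  ring

/-- The cubic governing the sign of the derivative changes sign exactly once on `(0, ∞)`. -/
lemma exists_cubic_eq_mul_pos (g : ℝ) (hg : -4 ≤ g) :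
    ∃ b₀ : ℝ, 0 < b₀ ∧ ∀ b : ℝ, 0 < b → ∃ q : ℝ, 0 < q ∧
      9 * b ^ 3 + (12 + 3 * g) * b ^ 2 - (2 * g + 12) * b - 4 = q * (b - b₀) := by
  obtain ⟨b₀, ⟨h0, -⟩, hroot⟩ := intermediate_value_Icc (show (0 : ℝ) ≤ 2 by norm_num)
    (f := fun b : ℝ => 9 * b ^ 3 + (12 + 3 * g) * b ^ 2 - (2 * g + 12) * b - 4)
    (by fun_prop) (show (0 : ℝ) ∈ Set.Icc _ _ from ⟨by norm_num, by linarith⟩)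
  simp only at hroot
  have hpos : 0 < b₀ := by
    refine lt_of_le_of_ne h0 fun h => ?_
    subst h
    norm_num at hroot
  refine ⟨b₀, hpos, fun b hb => ⟨9 * b ^ 2 + (12 + 3 * g + 9 * b₀) * b + 4 / b₀, ?_, ?_⟩⟩
  · have : 0 < 12 + 3 * g + 9 * b₀ := by linarith
    positivity
  · field_simp
    linear_combination b * hroot

/-- For `G ∈ {0,1,2,3}` and `H(b) = (3b² − 2(G−1)b + 2)³/(b²(3b+2)²)` on `(0,∞)`,
there is exactly one critical point `b₀ ∈ (0,∞)` of `H`, and `H` attains its global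
minimum on `(0,∞)` at `b₀`. -/
theorem stmt_6 (G : ℕ) (hG : G ≤ 3) (H : ℝ → ℝ)
    (hH : ∀ b, H b = (3 * b ^ 2 - 2 * ((G : ℝ) - 1) * b + 2) ^ 3 /
        (b ^ 2 * (3 * b + 2) ^ 2)) :
    ∃ b₀ : ℝ, 0 < b₀ ∧ deriv H b₀ = 0 ∧
      (∀ b : ℝ, 0 < b → deriv H b = 0 → b = b₀) ∧
      (∀ b : ℝ, 0 < b → H b₀ ≤ H b) := by
  have hG0 : (0 : ℝ) ≤ G := G.cast_nonneg
  have hG3 : (G : ℝ) ≤ 3 := by exact_mod_cast hG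
  obtain ⟨b₀, hb₀, hcubic⟩ := exists_cubic_eq_mul_pos ((G : ℝ) - 1) (by linarith)
  have hder : ∀ b : ℝ, 0 < b → ∃ r : ℝ, 0 < r ∧ HasDerivAt H (r * (b - b₀)) b := by
    intro b hb
    obtain ⟨q, hq, hqb⟩ := hcubic b hb
    have hN : 0 < 3 * b ^ 2 - 2 * ((G : ℝ) - 1) * b + 2 := by
      nlinarith [sq_nonneg (3 * b - 2), mul_nonneg hb.le (sub_nonneg.2 hG3)]
    refine ⟨2 * (3 * b ^ 2 - 2 * ((G : ℝ) - 1) * b + 2) ^ 2 / (b ^ 3 * (3 * b + 2) ^ 3) * q,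
      by positivity, ?_⟩
    rw [funext hH, mul_assoc, ← hqb]
    exact hasDerivAt_quotient _ b hb
  have hcont : ContinuousOn H (Set.Ioi 0) := fun b hb =>
    (hder b hb).choose_spec.2.continuousAt.continuousWithinAt
  have hdiff : DifferentiableOn ℝ H (Set.Ioi 0) := fun b hb =>
    (hder b hb).choose_spec.2.differentiableAt.differentiableWithinAt
  refine ⟨b₀, hb₀, ?_, fun b hb h => ?_, fun b hb => ?_⟩
  · obtain ⟨r, -, hr⟩ := hder b₀ hb₀
    simpa using hr.deriv
  · obtain ⟨r, hr0, hr⟩ := hder b hb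
    rw [hr.deriv] at h
    exact sub_eq_zero.1 ((mul_eq_zero.1 h).resolve_left hr0.ne')
  · rcases le_total b b₀ with h | h
    · have hsub : Set.Icc b b₀ ⊆ Set.Ioi 0 := fun x hx => hb.trans_le hx.1
      refine antitoneOn_of_deriv_nonpos (convex_Icc b b₀) (hcont.mono hsub)
        (hdiff.mono (interior_subset.trans hsub)) (fun x hx => ?_)
        (Set.left_mem_Icc.2 h) (Set.right_mem_Icc.2 h) h
      have hx' := interior_subset hx
      obtain ⟨r, hr0, hr⟩ := hder x (hsub hx')
      rw [hr.deriv]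
      exact mul_nonpos_of_nonneg_of_nonpos hr0.le (sub_nonpos.2 hx'.2)
    · have hsub : Set.Icc b₀ b ⊆ Set.Ioi 0 := fun x hx => hb₀.trans_le hx.1
      refine monotoneOn_of_deriv_nonneg (convex_Icc b₀ b) (hcont.mono hsub)
        (hdiff.mono (interior_subset.trans hsub)) (fun x hx => ?_)
        (Set.left_mem_Icc.2 h) (Set.right_mem_Icc.2 h) h
      have hx' := interior_subset hx
      obtain ⟨r, hr0, hr⟩ := hder x (hsub hx')
      rw [hr.deriv]
      exact mul_nonneg hr0.le (sub_nonneg.2 hx'.1)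
end

section
/- Let G be an integer with G ≥ 4 and define H(b) = (3b² − 2(G−1)b + 2)³/(b²(3b+2)²) for b > 0. Then the set {b ∈ (0,∞) : H′(b) = 0} has exactly three elements. -/
/-- The cubic factor of the numerator of the derivative of
`(3b² − 2cb + 2)³/(b²(3b+2)²)` has exactly one positive zero. -/
theorem existsUnique_pos_root_cubic {c : ℝ} (hc : 0 ≤ c) :
    ∃! b : ℝ, 0 < b ∧ 9 * b ^ 3 + (12 + 3 * c) * b ^ 2 - (2 * c + 12) * b - 4 = 0 := by
  have hcont : ContinuousOn
      (fun b : ℝ => 9 * b ^ 3 + (12 + 3 * c) * b ^ 2 - (2 * c + 12) * b - 4) (Set.Icc 0 1) := by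
    fun_prop
  obtain ⟨r, hr, hr0⟩ := intermediate_value_Ioo zero_le_one hcont
    (show (0 : ℝ) ∈ Set.Ioo _ _ by constructor <;> norm_num; linarith)
  refine ⟨r, ⟨hr.1, hr0⟩, ?_⟩
  rintro y ⟨hy, hy0⟩
  have hrpos : 0 < r := hr.1
  dsimp only at hr0
  have key : (y - r) * (9 * r * y * (r + y) + (12 + 3 * c) * (r * y) + 4) = 0 := by
    linear_combination r * hy0 - y * hr0
  have hne : 9 * r * y * (r + y) + (12 + 3 * c) * (r * y) + 4 ≠ 0 := by positivity
  exact sub_eq_zero.1 ((mul_eq_zero.1 key).resolve_right hne)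

theorem deriv_cube_div_sq {c b : ℝ} (hb : 0 < b) :
    deriv (fun b : ℝ => (3 * b ^ 2 - 2 * c * b + 2) ^ 3 / (b ^ 2 * (3 * b + 2) ^ 2)) b =
      2 * (3 * b ^ 2 - 2 * c * b + 2) ^ 2 *
        (9 * b ^ 3 + (12 + 3 * c) * b ^ 2 - (2 * c + 12) * b - 4) / (b ^ 3 * (3 * b + 2) ^ 3) := by
  have hid := hasDerivAt_id' b
  have hnum := ((((hid.pow 2).const_mul 3).sub (hid.const_mul (2 * c))).add_const 2).pow 3
  have hden := (hid.pow 2).mul (((hid.const_mul 3).add_const 2).pow 2)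
  have hne : b ^ 2 * (3 * b + 2) ^ 2 ≠ 0 := by positivity
  have hlin : 3 * b + 2 ≠ 0 := by positivity
  refine (hnum.div hden hne).deriv.trans ?_
  simp only [Pi.pow_apply, Pi.mul_apply, Pi.sub_apply]
  field_simp
  push_cast
  ring

/-- For an integer `G ≥ 4` and `H(b) = (3b² − 2(G−1)b + 2)³/(b²(3b+2)²)` on `(0,∞)`,
the set of critical points of `H` in `(0,∞)` has exactly three elements. -/
theorem stmt_7 (G : ℤ) (hG : 4 ≤ G) (H : ℝ → ℝ)
    (hH : ∀ b, H b = (3 * b ^ 2 - 2 * ((G : ℝ) - 1) * b + 2) ^ 3 /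
        (b ^ 2 * (3 * b + 2) ^ 2)) :
    {b : ℝ | 0 < b ∧ deriv H b = 0}.ncard = 3 := by
  have hG' : (4 : ℝ) ≤ G := by exact_mod_cast hG
  obtain rfl := funext hH
  clear hH
  generalize hc : (G : ℝ) - 1 = c
  have hc3 : 3 ≤ c := by linarith
  obtain ⟨r, ⟨hr, hr0⟩, huniq⟩ := existsUnique_pos_root_cubic (c := c) (by linarith)
  have hdisc : 0 < c ^ 2 - 6 := by nlinarith
  obtain ⟨s, hs, hs2⟩ : ∃ s : ℝ, 0 < s ∧ s ^ 2 = c ^ 2 - 6 :=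
    ⟨√(c ^ 2 - 6), Real.sqrt_pos.2 hdisc, Real.sq_sqrt hdisc.le⟩
  have hsc : s < c := by nlinarith
  have hfac (b : ℝ) :
      3 * b ^ 2 - 2 * c * b + 2 = 3 * ((b - (c - s) / 3) * (b - (c + s) / 3)) := by
    linear_combination (1 / 3 : ℝ) * hs2
  have hquad_ne : 3 * r ^ 2 - 2 * c * r + 2 ≠ 0 := by
    intro h
    have hprod : (6 * r - 2 * c) * (r * (3 * r + 2)) = 0 := by
      linear_combination (2 / 3 : ℝ) * hr0 + (2 / 3 : ℝ) * (6 * r + 2) * h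
    have hvertex : 6 * r - 2 * c = 0 := (mul_eq_zero.1 hprod).resolve_right (by positivity)
    nlinarith
  rw [Set.ncard_eq_three]
  refine ⟨(c - s) / 3, (c + s) / 3, r, by linarith, ?_, ?_, ?_⟩
  · rintro rfl
    exact hquad_ne (by rw [hfac]; ring)
  · rintro rfl
    exact hquad_ne (by rw [hfac]; ring)
  ext b
  simp only [Set.mem_ofPred_eq, Set.mem_insert_iff, Set.mem_singleton_iff]
  constructor
  · rintro ⟨hb, hb0⟩
    have hden : b ^ 3 * (3 * b + 2) ^ 3 ≠ 0 := by positivity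
    rw [deriv_cube_div_sq hb, div_eq_zero_iff, or_iff_left hden, mul_eq_zero, hfac] at hb0
    rcases hb0 with h | h
    · simp only [mul_eq_zero, pow_eq_zero_iff, ne_eq, OfNat.ofNat_ne_zero, not_false_eq_true,
        false_or, sub_eq_zero] at h
      tauto
    · exact .inr (.inr (huniq b ⟨hb, h⟩))
  · rintro (rfl | rfl | rfl)
    · have hb : 0 < (c - s) / 3 := by linarith
      exact ⟨hb, by rw [deriv_cube_div_sq hb, hfac]; simp⟩
    · have hb : 0 < (c + s) / 3 := by linarith
      exact ⟨hb, by rw [deriv_cube_div_sq hb, hfac]; simp⟩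
    · exact ⟨hr, by rw [deriv_cube_div_sq hr, hr0]; simp⟩
end

section
/- Let G be a nonnegative integer with G ≤ 17 and define g₂(b) = 81b⁵ + 27(15−G)b⁴ + (558−36G)b³ + (456−24G)b² + (176−8G)b + 16. Then g₂(b) > 0 for all b > 0. -/
/-- For a nonnegative integer `G ≤ 17`, the quintic
`g₂(b) = 81b⁵ + 27(15−G)b⁴ + (558−36G)b³ + (456−24G)b² + (176−8G)b + 16`
is positive for all `b > 0`. -/
theorem stmt_9 (G : ℕ) (hG : G ≤ 17) :
    ∀ b : ℝ, 0 < b →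
      0 < 81 * b ^ 5 + 27 * (15 - (G : ℝ)) * b ^ 4 + (558 - 36 * (G : ℝ)) * b ^ 3
        + (456 - 24 * (G : ℝ)) * b ^ 2 + (176 - 8 * (G : ℝ)) * b + 16 := by
  intro b hb
  have hG' : (0 : ℝ) ≤ 17 - G := sub_nonneg.mpr (by exact_mod_cast hG)
  calc
    (0 : ℝ) < (17 - G) * (27 * b ^ 4 + 36 * b ^ 3 + 24 * b ^ 2 + 8 * b)
        + 81 * b ^ 3 * (b - 2 / 3) ^ 2 + 54 * b ^ 2 * (b - 5 / 6) ^ 2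
        + 21 / 2 * b ^ 2 + 40 * b + 16 := by positivity
    _ = _ := by ring
end

section
/- Let G be an integer with G ≥ 18 and define g₂(b) = 81b⁵ + 27(15−G)b⁴ + (558−36G)b³ + (456−24G)b² + (176−8G)b + 16. Then there exist b₁, b₂ with 0 < b₁ < b₂ and g₂(b₁) = 0 = g₂(b₂); that is, g₂ has two distinct positive real roots. -/
/-- For an integer `G ≥ 18`, the quintic
`g₂(b) = 81b⁵ + 27(15−G)b⁴ + (558−36G)b³ + (456−24G)b² + (176−8G)b + 16`
has two distinct positive real roots. -/
theorem stmt_10 (G : ℤ) (hG : 18 ≤ G) :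
    ∃ b₁ b₂ : ℝ, 0 < b₁ ∧ b₁ < b₂ ∧
      (81 * b₁ ^ 5 + 27 * (15 - (G : ℝ)) * b₁ ^ 4 + (558 - 36 * (G : ℝ)) * b₁ ^ 3
        + (456 - 24 * (G : ℝ)) * b₁ ^ 2 + (176 - 8 * (G : ℝ)) * b₁ + 16 = 0) ∧
      (81 * b₂ ^ 5 + 27 * (15 - (G : ℝ)) * b₂ ^ 4 + (558 - 36 * (G : ℝ)) * b₂ ^ 3
        + (456 - 24 * (G : ℝ)) * b₂ ^ 2 + (176 - 8 * (G : ℝ)) * b₂ + 16 = 0) := by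
  have hG' : (18 : ℝ) ≤ G := by exact_mod_cast hG
  set f : ℝ → ℝ := fun b ↦ 81 * b ^ 5 + 27 * (15 - (G : ℝ)) * b ^ 4
    + (558 - 36 * (G : ℝ)) * b ^ 3 + (456 - 24 * (G : ℝ)) * b ^ 2
    + (176 - 8 * (G : ℝ)) * b + 16 with hf
  have hcont : Continuous f := by fun_prop
  have h0 : 0 < f 0 := by norm_num [hf]
  have h1 : f 1 < 0 := by simp only [hf]; linarith
  have h2 : 0 < f G := by
    have h : f G = 54 * (G : ℝ) ^ 5 + 369 * (G : ℝ) ^ 4 + 534 * (G : ℝ) ^ 3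
        + 448 * (G : ℝ) ^ 2 + 176 * (G : ℝ) + 16 := by simp only [hf]; ring
    rw [h]
    have : (0 : ℝ) < G := by linarith
    positivity
  obtain ⟨b₁, ⟨hb₁, hb₁'⟩, e₁⟩ :=
    intermediate_value_Ioo' zero_le_one hcont.continuousOn ⟨h1, h0⟩
  obtain ⟨b₂, ⟨hb₂, -⟩, e₂⟩ :=
    intermediate_value_Ioo (by linarith : (1 : ℝ) ≤ G) hcont.continuousOn ⟨h1, h2⟩
  exact ⟨b₁, b₂, hb₁, hb₁'.trans hb₂, e₁, e₂⟩
end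

section
/- Let G be a nonnegative integer with G ≤ 17 and define SE(b) = (27b⁵ + 54b⁴ + (6G²−36G−6)b³ + (4G²−32G+4)b² + 36b + 8)³/(b⁴(3b+2)(9b²+24b+4)³) for b > 0. Then there is exactly one b₀ ∈ (0,∞) with SE′(b₀) = 0, and SE attains its global minimum on (0,∞) at b₀. -/
/-- The base of the cube in the numerator of `SE`. -/
def energyNum (G b : ℝ) : ℝ :=
  27 * b ^ 5 + 54 * b ^ 4 + (6 * G ^ 2 - 36 * G - 6) * b ^ 3
    + (4 * G ^ 2 - 32 * G + 4) * b ^ 2 + 36 * b + 8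

/-- The factor of the numerator of `SE'` that carries its sign. -/
def derivNum (G b : ℝ) : ℝ :=
  2916 * b ^ 8 + 17496 * b ^ 7 + (31428 + 1944 * G - 324 * G ^ 2) * b ^ 6
    + (19008 + 2376 * G - 216 * G ^ 2) * b ^ 5 + (-6048 + 1728 * G) * b ^ 4
    + (-20256 - 288 * G + 96 * G ^ 2) * b ^ 3 + (-13760 - 512 * G + 64 * G ^ 2) * b ^ 2
    - 3456 * b - 256

lemma energyNum_pos (G : ℕ) (hG : G ≤ 17) (b : ℝ) (hb : 0 < b) : 0 < energyNum G b := by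
  unfold energyNum
  interval_cases G <;> norm_num <;>
    nlinarith [sq_nonneg (b - 4 / 5), mul_nonneg hb.le (sq_nonneg (b - 4 / 5)),
      mul_nonneg (pow_pos hb 2).le (sq_nonneg (b - 4 / 5)),
      mul_nonneg (pow_pos hb 3).le (sq_nonneg (b - 4 / 5)),
      pow_pos hb 2, pow_pos hb 3, pow_pos hb 4, pow_pos hb 5]

lemma derivNum_div_deriv_num_pos (G : ℕ) (hG : G ≤ 17) (b : ℝ) (hb : 0 < b) :
    0 < 11664 * b ^ 8 + 52488 * b ^ 7 + 2 * (31428 + 1944 * (G : ℝ) - 324 * (G : ℝ) ^ 2) * b ^ 6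
      + (19008 + 2376 * (G : ℝ) - 216 * (G : ℝ) ^ 2) * b ^ 5
      + (20256 + 288 * (G : ℝ) - 96 * (G : ℝ) ^ 2) * b ^ 3
      + 2 * (13760 + 512 * (G : ℝ) - 64 * (G : ℝ) ^ 2) * b ^ 2 + 10368 * b + 1024 := by
  have h2 := pow_pos hb 2
  have h3 := pow_pos hb 3
  have h5 := pow_pos hb 5
  have h6 := pow_pos hb 6
  have h7 := pow_pos hb 7
  have h8 := pow_pos hb 8
  interval_cases G <;> norm_num <;>
    nlinarith [mul_nonneg h5.le (sq_nonneg (b - 1)), mul_nonneg h6.le (sq_nonneg (b - 1)),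
      mul_nonneg h3.le (sq_nonneg (b - 1)), mul_nonneg (pow_pos hb 4).le (sq_nonneg (b - 1)),
      mul_nonneg h2.le (sq_nonneg (b - 1)), mul_nonneg hb.le (sq_nonneg (b - 1))]

lemma strictMonoOn_derivNum_div (G : ℕ) (hG : G ≤ 17) :
    StrictMonoOn (fun b => derivNum G b / b ^ 4) (Set.Ioi 0) := by
  refine strictMonoOn_of_deriv_pos (convex_Ioi 0) ?_ ?_
  · unfold derivNum
    exact ContinuousOn.div (by fun_prop) (by fun_prop) fun b hb => (pow_pos hb 4).ne'
  · intro b hb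
    rw [interior_Ioi] at hb
    have hb0 : (0 : ℝ) < b := hb
    have key : HasDerivAt (fun b => derivNum G b / b ^ 4)
        ((11664 * b ^ 8 + 52488 * b ^ 7
          + 2 * (31428 + 1944 * (G : ℝ) - 324 * (G : ℝ) ^ 2) * b ^ 6
          + (19008 + 2376 * (G : ℝ) - 216 * (G : ℝ) ^ 2) * b ^ 5
          + (20256 + 288 * (G : ℝ) - 96 * (G : ℝ) ^ 2) * b ^ 3
          + 2 * (13760 + 512 * (G : ℝ) - 64 * (G : ℝ) ^ 2) * b ^ 2 + 10368 * b + 1024)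
            / b ^ 5) b := by
      have hd : DifferentiableAt ℝ (derivNum G) b := by unfold derivNum; fun_prop
      have h := hd.hasDerivAt.div (hasDerivAt_pow 4 b) (pow_pos hb0 4).ne'
      have e : deriv (derivNum G) b = 8 * 2916 * b ^ 7 + 7 * 17496 * b ^ 6
          + 6 * (31428 + 1944 * (G : ℝ) - 324 * (G : ℝ) ^ 2) * b ^ 5
          + 5 * (19008 + 2376 * (G : ℝ) - 216 * (G : ℝ) ^ 2) * b ^ 4
          + 4 * (-6048 + 1728 * (G : ℝ)) * b ^ 3
          + 3 * (-20256 - 288 * (G : ℝ) + 96 * (G : ℝ) ^ 2) * b ^ 2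
          + 2 * (-13760 - 512 * (G : ℝ) + 64 * (G : ℝ) ^ 2) * b - 3456 := by
        apply HasDerivAt.deriv
        have p := fun n : ℕ => hasDerivAt_pow n b
        have := (((((((((p 8).const_mul 2916).add ((p 7).const_mul 17496)).add
          ((p 6).const_mul (31428 + 1944 * (G : ℝ) - 324 * (G : ℝ) ^ 2))).add
          ((p 5).const_mul (19008 + 2376 * (G : ℝ) - 216 * (G : ℝ) ^ 2))).add
          ((p 4).const_mul (-6048 + 1728 * (G : ℝ)))).add
          ((p 3).const_mul (-20256 - 288 * (G : ℝ) + 96 * (G : ℝ) ^ 2))).add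
          ((p 2).const_mul (-13760 - 512 * (G : ℝ) + 64 * (G : ℝ) ^ 2))).sub
          ((hasDerivAt_id b).const_mul 3456)).sub_const 256
        refine this.congr_deriv ?_
        norm_num
        ring
      refine h.congr_deriv ?_
      rw [e]
      unfold derivNum
      field_simp
      push_cast
      ring
    rw [key.deriv]
    exact div_pos (derivNum_div_deriv_num_pos G hG b hb0) (pow_pos hb0 5)

lemma hasDerivAt_energy (G b : ℝ) (hb : 0 < b) :
    HasDerivAt (fun b => energyNum G b ^ 3 / (b ^ 4 * (3 * b + 2) * (9 * b ^ 2 + 24 * b + 4) ^ 3))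
      (energyNum G b ^ 2 / (b * (3 * b + 2) ^ 2 * (9 * b ^ 2 + 24 * b + 4) ^ 4)
        * (derivNum G b / b ^ 4)) b := by
  have p := fun n : ℕ => hasDerivAt_pow n b
  have hg : HasDerivAt (energyNum G) (135 * b ^ 4 + 216 * b ^ 3
      + 3 * (6 * G ^ 2 - 36 * G - 6) * b ^ 2 + 2 * (4 * G ^ 2 - 32 * G + 4) * b + 36) b := by
    have := ((((((p 5).const_mul 27).add ((p 4).const_mul 54)).add
      ((p 3).const_mul (6 * G ^ 2 - 36 * G - 6))).add
      ((p 2).const_mul (4 * G ^ 2 - 32 * G + 4))).add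
      ((hasDerivAt_id b).const_mul 36)).add_const 8
    refine this.congr_deriv ?_
    norm_num
    ring
  have hD : HasDerivAt (fun b : ℝ => 3 * b + 2) 3 b := by
    simpa using ((hasDerivAt_id b).const_mul 3).add_const 2
  have hQ : HasDerivAt (fun b : ℝ => 9 * b ^ 2 + 24 * b + 4) (18 * b + 24) b := by
    refine ((((p 2).const_mul 9).add ((hasDerivAt_id b).const_mul 24)).add_const 4).congr_deriv ?_
    norm_num
    ring
  have hden : b ^ 4 * (3 * b + 2) * (9 * b ^ 2 + 24 * b + 4) ^ 3 ≠ 0 := by positivity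
  refine ((hg.pow 3).div (((p 4).mul hD).mul (hQ.pow 3)) hden).congr_deriv ?_
  have h1 : 3 * b + 2 ≠ 0 := by positivity
  have h2 : 9 * b ^ 2 + 24 * b + 4 ≠ 0 := by positivity
  simp only [Pi.mul_apply, Pi.pow_apply]
  have key : derivNum G b = 3 * (135 * b ^ 4 + 216 * b ^ 3
      + 3 * (6 * G ^ 2 - 36 * G - 6) * b ^ 2 + 2 * (4 * G ^ 2 - 32 * G + 4) * b + 36)
        * b * (3 * b + 2) * (9 * b ^ 2 + 24 * b + 4)
      - energyNum G b * (4 * (3 * b + 2) * (9 * b ^ 2 + 24 * b + 4)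
        + 3 * b * (9 * b ^ 2 + 24 * b + 4) + 3 * b * (3 * b + 2) * (18 * b + 24)) := by
    unfold derivNum energyNum
    ring
  rw [key]
  generalize energyNum G b = g
  generalize 135 * b ^ 4 + 216 * b ^ 3
      + 3 * (6 * G ^ 2 - 36 * G - 6) * b ^ 2 + 2 * (4 * G ^ 2 - 32 * G + 4) * b + 36 = g'
  generalize 9 * b ^ 2 + 24 * b + 4 = q at *
  generalize 3 * b + 2 = d at *
  generalize 18 * b + 24 = q'
  field_simp
  push_cast
  ring

/-- For a nonnegative integer `G ≤ 17` and
`SE(b) = (27b⁵ + 54b⁴ + (6G²−36G−6)b³ + (4G²−32G+4)b² + 36b + 8)³/(b⁴(3b+2)(9b²+24b+4)³)`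
on `(0,∞)`, there is exactly one critical point `b₀ ∈ (0,∞)` of `SE`, and `SE` attains
its global minimum on `(0,∞)` at `b₀`. -/
theorem stmt_11 (G : ℕ) (hG : G ≤ 17) (SE : ℝ → ℝ)
    (hSE : ∀ b, SE b = (27 * b ^ 5 + 54 * b ^ 4
        + (6 * (G : ℝ) ^ 2 - 36 * (G : ℝ) - 6) * b ^ 3
        + (4 * (G : ℝ) ^ 2 - 32 * (G : ℝ) + 4) * b ^ 2 + 36 * b + 8) ^ 3 /
        (b ^ 4 * (3 * b + 2) * (9 * b ^ 2 + 24 * b + 4) ^ 3)) :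
    ∃ b₀ : ℝ, 0 < b₀ ∧ deriv SE b₀ = 0 ∧
      (∀ b : ℝ, 0 < b → deriv SE b = 0 → b = b₀) ∧
      (∀ b : ℝ, 0 < b → SE b₀ ≤ SE b) := by
  have hder : ∀ b, 0 < b → HasDerivAt SE
      (energyNum G b ^ 2 / (b * (3 * b + 2) ^ 2 * (9 * b ^ 2 + 24 * b + 4) ^ 4)
        * (derivNum G b / b ^ 4)) b := by
    intro b hb
    rw [show SE = _ from funext hSE]
    exact hasDerivAt_energy G b hb
  have hfac : ∀ b : ℝ, 0 < b →
      0 < energyNum G b ^ 2 / (b * (3 * b + 2) ^ 2 * (9 * b ^ 2 + 24 * b + 4) ^ 4) := by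
    intro b hb
    have := energyNum_pos G hG b hb
    positivity
  have hmono := strictMonoOn_derivNum_div G hG
  obtain ⟨b₀, hb₀, hroot⟩ : ∃ b₀ ∈ Set.Icc (1 / 2 : ℝ) 1, derivNum G b₀ = 0 := by
    refine intermediate_value_Icc (f := derivNum G) (by norm_num)
      (by unfold derivNum; fun_prop) ⟨?_, ?_⟩
    · unfold derivNum
      interval_cases G <;> norm_num
    · unfold derivNum
      interval_cases G <;> norm_num
  have hpos : 0 < b₀ := lt_of_lt_of_le (by norm_num) hb₀.1
  have hzero : derivNum G b₀ / b₀ ^ 4 = 0 := by rw [hroot, zero_div]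
  refine ⟨b₀, hpos, by rw [(hder b₀ hpos).deriv, hzero, mul_zero], fun b hb h => ?_, ?_⟩
  · rw [(hder b hb).deriv] at h
    have h0 := (mul_eq_zero.mp h).resolve_left (hfac b hb).ne'
    exact hmono.injOn hb hpos (h0.trans hzero.symm)
  intro b hb
  rcases le_total b b₀ with hle | hle
  · have hanti : AntitoneOn SE (Set.Icc b b₀) := by
      refine antitoneOn_of_deriv_nonpos (convex_Icc _ _) (fun x hx =>
        (hder x (hb.trans_le hx.1)).continuousAt.continuousWithinAt) (fun x hx => ?_)
        fun x hx => ?_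
      all_goals
        rw [interior_Icc] at hx
        have hx0 : 0 < x := hb.trans hx.1
      · exact (hder x hx0).differentiableAt.differentiableWithinAt
      · rw [(hder x hx0).deriv]
        refine mul_nonpos_of_nonneg_of_nonpos (hfac x hx0).le ?_
        exact (hmono hx0 hpos hx.2).le.trans hzero.le
    exact hanti ⟨le_rfl, hle⟩ ⟨hle, le_rfl⟩ hle
  · have hmon : MonotoneOn SE (Set.Icc b₀ b) := by
      refine monotoneOn_of_deriv_nonneg (convex_Icc _ _) (fun x hx =>
        (hder x (hpos.trans_le hx.1)).continuousAt.continuousWithinAt) (fun x hx => ?_)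
        fun x hx => ?_
      all_goals
        rw [interior_Icc] at hx
        have hx0 : 0 < x := hpos.trans hx.1
      · exact (hder x hx0).differentiableAt.differentiableWithinAt
      · rw [(hder x hx0).deriv]
        refine mul_nonneg (hfac x hx0).le ?_
        exact hzero.ge.trans (hmono hpos hx0 hx.1).le
    exact hmon ⟨le_rfl, hle⟩ ⟨hle, le_rfl⟩ hle
end

section
/- Define SE(b) = (27b⁵ + 54b⁴ + 58746b³ + 38356b² + 36b + 8)³/(b⁴(3b+2)(9b²+24b+4)³) for b > 0. Then the set {b ∈ (0,∞) : SE′(b) = 0} has exactly three elements: one in (0.02, 0.03), one in (0.68, 0.69), and one in (30, 31). The critical point in (0.68, 0.69) is a local maximum of SE, the other two are local minima, and the critical point in (30, 31) is the global minimum of SE on (0,∞). -/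
/-- The numerator of the logarithmic derivative of the Sasaki energy. -/
def critPoly (b : ℝ) : ℝ :=
  2916 * b ^ 8 + 17496 * b ^ 7 - 3141180 * b ^ 6 - 1985904 * b ^ 5 + 170208 * b ^ 4
    + 949152 * b ^ 3 + 599872 * b ^ 2 - 3456 * b - 256

/-- The derivative of `critPoly`. -/
def critPolyDeriv (b : ℝ) : ℝ :=
  23328 * b ^ 7 + 122472 * b ^ 6 - 18847080 * b ^ 5 - 9929520 * b ^ 4 + 680832 * b ^ 3
    + 2847456 * b ^ 2 + 1199744 * b - 3456

lemma hasDerivAt_critPoly (b : ℝ) : HasDerivAt critPoly (critPolyDeriv b) b := by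
  have h (n : ℕ) (c : ℝ) : HasDerivAt (fun x : ℝ => c * x ^ n) (c * (n * b ^ (n - 1))) b :=
    (hasDerivAt_pow n b).const_mul c
  have := ((((((((h 8 2916).add (h 7 17496)).sub (h 6 3141180)).sub (h 5 1985904)).add
    (h 4 170208)).add (h 3 949152)).add (h 2 599872)).sub (h 1 3456)).sub_const 256
  refine (this.congr_deriv ?_).congr_of_eventuallyEq (.of_forall fun x => ?_)
  · simp only [critPolyDeriv]
    push_cast
    ring
  · simp [critPoly]

lemma continuous_critPoly : Continuous critPoly := by
  unfold critPoly
  fun_prop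

/-- Möbius parametrization of a half-open interval by the nonnegative reals. -/
lemma exists_eq_div_of_mem_Ico {a b c : ℝ} (h : b ∈ Set.Ico a c) :
    ∃ t : ℝ, 0 ≤ t ∧ b = (a + c * t) / (1 + t) := by
  obtain ⟨h1, h2⟩ := h
  have hc : 0 < c - b := sub_pos.2 h2
  have ht : 0 ≤ (b - a) / (c - b) := div_nonneg (sub_nonneg.2 h1) hc.le
  refine ⟨(b - a) / (c - b), ht, ?_⟩
  rw [eq_div_iff (by positivity)]
  field_simp
  ring

lemma critPoly_neg_of_mem_Ico_zero {b : ℝ} (h : b ∈ Set.Ico (0 : ℝ) (2 / 100)) :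
    critPoly b < 0 := by
  obtain ⟨t, ht, rfl⟩ := exists_eq_div_of_mem_Ico h
  rw [← neg_pos, critPoly]
  field_simp
  ring_nf
  positivity

lemma critPoly_pos_of_mem_Ico {b : ℝ} (h : b ∈ Set.Ico (3 / 100 : ℝ) (68 / 100)) :
    0 < critPoly b := by
  obtain ⟨t, ht, rfl⟩ := exists_eq_div_of_mem_Ico h
  rw [critPoly]
  field_simp
  ring_nf
  positivity

lemma critPoly_neg_of_mem_Ico {b : ℝ} (h : b ∈ Set.Ico (69 / 100 : ℝ) 30) :
    critPoly b < 0 := by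
  obtain ⟨t, ht, rfl⟩ := exists_eq_div_of_mem_Ico h
  rw [← neg_pos, critPoly]
  field_simp
  ring_nf
  positivity

lemma critPoly_pos_of_le {b : ℝ} (h : 31 ≤ b) : 0 < critPoly b := by
  obtain ⟨t, rfl⟩ := exists_add_of_le h
  have ht : 0 ≤ t := by linarith
  rw [critPoly]
  ring_nf
  positivity

lemma critPolyDeriv_pos_of_mem_Ico {b : ℝ} (h : b ∈ Set.Ico (2 / 100 : ℝ) (3 / 100)) :
    0 < critPolyDeriv b := by
  obtain ⟨t, ht, rfl⟩ := exists_eq_div_of_mem_Ico h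
  rw [critPolyDeriv]
  field_simp
  ring_nf
  positivity

lemma critPolyDeriv_neg_of_mem_Ico {b : ℝ} (h : b ∈ Set.Ico (68 / 100 : ℝ) (69 / 100)) :
    critPolyDeriv b < 0 := by
  obtain ⟨t, ht, rfl⟩ := exists_eq_div_of_mem_Ico h
  rw [← neg_pos, critPolyDeriv]
  field_simp
  ring_nf
  positivity

lemma critPolyDeriv_pos_of_le {b : ℝ} (h : 30 ≤ b) : 0 < critPolyDeriv b := by
  obtain ⟨t, rfl⟩ := exists_add_of_le h
  have ht : 0 ≤ t := by linarith
  rw [critPolyDeriv]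
  ring_nf
  positivity

/-- `critPoly` has exactly three positive roots, and changes sign at each of them. -/
lemma exists_critPoly_roots : ∃ b₁ b₂ b₃ : ℝ,
    b₁ ∈ Set.Ioo (2 / 100 : ℝ) (3 / 100) ∧ b₂ ∈ Set.Ioo (68 / 100 : ℝ) (69 / 100) ∧
    b₃ ∈ Set.Ioo (30 : ℝ) 31 ∧
    critPoly b₁ = 0 ∧ critPoly b₂ = 0 ∧ critPoly b₃ = 0 ∧
    (∀ b, 0 < b → b < b₁ → critPoly b < 0) ∧ (∀ b, b₁ < b → b < b₂ → 0 < critPoly b) ∧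
    (∀ b, b₂ < b → b < b₃ → critPoly b < 0) ∧ (∀ b, b₃ < b → 0 < critPoly b) := by
  have hm₁ : StrictMonoOn critPoly (Set.Icc (2 / 100 : ℝ) (3 / 100)) :=
    strictMonoOn_of_deriv_pos (convex_Icc _ _) continuous_critPoly.continuousOn fun x hx => by
      rw [interior_Icc] at hx
      rw [(hasDerivAt_critPoly x).deriv]
      exact critPolyDeriv_pos_of_mem_Ico ⟨hx.1.le, hx.2⟩
  have hm₂ : StrictAntiOn critPoly (Set.Icc (68 / 100 : ℝ) (69 / 100)) :=
    strictAntiOn_of_deriv_neg (convex_Icc _ _) continuous_critPoly.continuousOn fun x hx => by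
      rw [interior_Icc] at hx
      rw [(hasDerivAt_critPoly x).deriv]
      exact critPolyDeriv_neg_of_mem_Ico ⟨hx.1.le, hx.2⟩
  have hm₃ : StrictMonoOn critPoly (Set.Icc (30 : ℝ) 31) :=
    strictMonoOn_of_deriv_pos (convex_Icc _ _) continuous_critPoly.continuousOn fun x hx => by
      rw [interior_Icc] at hx
      rw [(hasDerivAt_critPoly x).deriv]
      exact critPolyDeriv_pos_of_le hx.1.le
  obtain ⟨b₁, h₁, hb₁⟩ := intermediate_value_Ioo (by norm_num : (2 / 100 : ℝ) ≤ 3 / 100)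
    continuous_critPoly.continuousOn
    (show (0 : ℝ) ∈ Set.Ioo _ _ by constructor <;> norm_num [critPoly])
  obtain ⟨b₂, h₂, hb₂⟩ := intermediate_value_Ioo' (by norm_num : (68 / 100 : ℝ) ≤ 69 / 100)
    continuous_critPoly.continuousOn
    (show (0 : ℝ) ∈ Set.Ioo _ _ by constructor <;> norm_num [critPoly])
  obtain ⟨b₃, h₃, hb₃⟩ := intermediate_value_Ioo (by norm_num : (30 : ℝ) ≤ 31)
    continuous_critPoly.continuousOn
    (show (0 : ℝ) ∈ Set.Ioo _ _ by constructor <;> norm_num [critPoly])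
  have ⟨l₁, u₁⟩ := h₁
  have ⟨l₂, u₂⟩ := h₂
  have ⟨l₃, u₃⟩ := h₃
  refine ⟨b₁, b₂, b₃, h₁, h₂, h₃, hb₁, hb₂, hb₃, fun b h0 h => ?_, fun b h h' => ?_,
    fun b h h' => ?_, fun b h => ?_⟩
  · rcases lt_or_ge b (2 / 100) with hb | hb
    · exact critPoly_neg_of_mem_Ico_zero ⟨h0.le, hb⟩
    · exact hb₁ ▸ hm₁ ⟨hb, (h.trans u₁).le⟩ ⟨l₁.le, u₁.le⟩ h
  · rcases le_or_gt b (3 / 100) with hb | hb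
    · exact hb₁ ▸ hm₁ ⟨l₁.le, u₁.le⟩ ⟨(l₁.trans h).le, hb⟩ h
    rcases lt_or_ge b (68 / 100) with hb' | hb'
    · exact critPoly_pos_of_mem_Ico ⟨hb.le, hb'⟩
    · exact hb₂ ▸ hm₂ ⟨hb', (h'.trans u₂).le⟩ ⟨l₂.le, u₂.le⟩ h'
  · rcases le_or_gt b (69 / 100) with hb | hb
    · exact hb₂ ▸ hm₂ ⟨l₂.le, u₂.le⟩ ⟨(l₂.trans h).le, hb⟩ h
    rcases lt_or_ge b 30 with hb' | hb'
    · exact critPoly_neg_of_mem_Ico ⟨hb.le, hb'⟩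
    · exact hb₃ ▸ hm₃ ⟨hb', (h'.trans u₃).le⟩ ⟨l₃.le, u₃.le⟩ h'
  · rcases le_or_gt b 31 with hb | hb
    · exact hb₃ ▸ hm₃ ⟨l₃.le, u₃.le⟩ ⟨(l₃.trans h).le, hb⟩ h
    · exact critPoly_pos_of_le hb.le

/-- The Sasaki energy as an explicit rational function. -/
noncomputable def sasakiEnergy (b : ℝ) : ℝ :=
  (27 * b ^ 5 + 54 * b ^ 4 + 58746 * b ^ 3 + 38356 * b ^ 2 + 36 * b + 8) ^ 3 /
    (b ^ 4 * (3 * b + 2) * (9 * b ^ 2 + 24 * b + 4) ^ 3)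

lemma hasDerivAt_sasakiEnergy {b : ℝ} (hb : 0 < b) :
    HasDerivAt sasakiEnergy
      ((27 * b ^ 5 + 54 * b ^ 4 + 58746 * b ^ 3 + 38356 * b ^ 2 + 36 * b + 8) ^ 2 /
        (b ^ 5 * (3 * b + 2) ^ 2 * (9 * b ^ 2 + 24 * b + 4) ^ 4) * critPoly b) b := by
  have h (n : ℕ) (c : ℝ) : HasDerivAt (fun x : ℝ => c * x ^ n) (c * (n * b ^ (n - 1))) b :=
    (hasDerivAt_pow n b).const_mul c
  have hN := ((((((h 5 27).add (h 4 54)).add (h 3 58746)).add (h 2 38356)).add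
    (h 1 36)).add_const 8).pow 3
  have hD := ((h 4 1).mul ((h 1 3).add_const 2)).mul
    ((((h 2 9).add (h 1 24)).add_const 4).pow 3)
  have := hN.div hD (by simp only [Pi.mul_apply, Pi.add_apply, Pi.pow_apply]; positivity)
  refine (this.congr_deriv ?_).congr_of_eventuallyEq (.of_forall fun x => ?_)
  · simp only [critPoly, Pi.mul_apply, Pi.add_apply, Pi.pow_apply]
    push_cast
    field_simp
    ring
  · simp [sasakiEnergy]

lemma sasakiEnergy_ge {b : ℝ} (h : b ∈ Set.Ioo (2 / 100 : ℝ) (3 / 100)) :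
    250000000 ≤ sasakiEnergy b := by
  obtain ⟨h1, h2⟩ := h
  have hb : 0 < b := by linarith
  have hN : 1200 * b ≤ 27 * b ^ 5 + 54 * b ^ 4 + 58746 * b ^ 3 + 38356 * b ^ 2 + 36 * b + 8 := by
    have : 0 ≤ 27 * b ^ 5 + 54 * b ^ 4 + 58746 * b ^ 3 := by positivity
    nlinarith [sq_nonneg (38356 * b - 582)]
  have hQ : 9 * b ^ 2 + 24 * b + 4 ≤ 4.7281 := by nlinarith
  have hL : 3 * b + 2 ≤ 2.09 := by linarith
  rw [sasakiEnergy, le_div_iff₀ (by positivity)]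
  calc 250000000 * (b ^ 4 * (3 * b + 2) * (9 * b ^ 2 + 24 * b + 4) ^ 3)
      ≤ 250000000 * (b ^ 3 * (3 / 100) * 2.09 * 4.7281 ^ 3) := by
        rw [pow_succ b 3]
        gcongr
    _ ≤ (1200 * b) ^ 3 := by nlinarith [pow_pos hb 3]
    _ ≤ _ := by gcongr

/-- For `SE(b) = (27b⁵ + 54b⁴ + 58746b³ + 38356b² + 36b + 8)³/(b⁴(3b+2)(9b²+24b+4)³)`
on `(0,∞)`, the critical set of `SE` in `(0,∞)` consists of exactly three points, one
in `(0.02,0.03)`, one in `(0.68,0.69)` and one in `(30,31)`; the middle one is a local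
maximum, the other two are local minima, and the one in `(30,31)` is the global minimum
of `SE` on `(0,∞)`. -/
theorem stmt_12 (SE : ℝ → ℝ)
    (hSE : ∀ b, SE b = (27 * b ^ 5 + 54 * b ^ 4 + 58746 * b ^ 3 + 38356 * b ^ 2
        + 36 * b + 8) ^ 3 / (b ^ 4 * (3 * b + 2) * (9 * b ^ 2 + 24 * b + 4) ^ 3)) :
    ∃ b₁ b₂ b₃ : ℝ,
      b₁ ∈ Set.Ioo (0.02 : ℝ) 0.03 ∧ b₂ ∈ Set.Ioo (0.68 : ℝ) 0.69 ∧
      b₃ ∈ Set.Ioo (30 : ℝ) 31 ∧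
      {b : ℝ | 0 < b ∧ deriv SE b = 0} = {b₁, b₂, b₃} ∧
      IsLocalMax SE b₂ ∧ IsLocalMin SE b₁ ∧ IsLocalMin SE b₃ ∧
      (∀ b : ℝ, 0 < b → SE b₃ ≤ SE b) := by
  obtain rfl : SE = sasakiEnergy := funext hSE
  obtain ⟨b₁, b₂, b₃, h₁, h₂, h₃, hb₁, hb₂, hb₃, hs₀, hs₁, hs₂, hs₃⟩ := exists_critPoly_roots
  have ⟨l₁, u₁⟩ := h₁
  have ⟨l₂, u₂⟩ := h₂
  have ⟨l₃, u₃⟩ := h₃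
  have hpos₁ : 0 < b₁ := by linarith
  have h₁₂ : b₁ < b₂ := by linarith
  have h₂₃ : b₂ < b₃ := by linarith
  have hc {s : Set ℝ} (hs : ∀ x ∈ s, 0 < x) : ContinuousOn sasakiEnergy s := fun x hx =>
    (hasDerivAt_sasakiEnergy (hs x hx)).continuousAt.continuousWithinAt
  have hd {b : ℝ} (hb : 0 < b) : ∃ c : ℝ, 0 < c ∧ deriv sasakiEnergy b = c * critPoly b :=
    ⟨_, by positivity, (hasDerivAt_sasakiEnergy hb).deriv⟩
  have hdneg {b : ℝ} (hb : 0 < b) (h : critPoly b < 0) : deriv sasakiEnergy b < 0 := by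
    obtain ⟨c, hc, h'⟩ := hd hb
    exact h' ▸ mul_neg_of_pos_of_neg hc h
  have hdpos {b : ℝ} (hb : 0 < b) (h : 0 < critPoly b) : 0 < deriv sasakiEnergy b := by
    obtain ⟨c, hc, h'⟩ := hd hb
    exact h' ▸ mul_pos hc h
  have hm₀ : StrictAntiOn sasakiEnergy (Set.Ioc 0 b₁) :=
    strictAntiOn_of_deriv_neg (convex_Ioc _ _) (hc fun x hx => hx.1) fun x hx => by
      rw [interior_Ioc] at hx
      exact hdneg hx.1 (hs₀ x hx.1 hx.2)
  have hm₁ : StrictMonoOn sasakiEnergy (Set.Icc b₁ b₂) :=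
    strictMonoOn_of_deriv_pos (convex_Icc _ _) (hc fun x hx => hpos₁.trans_le hx.1) fun x hx => by
      rw [interior_Icc] at hx
      exact hdpos (hpos₁.trans hx.1) (hs₁ x hx.1 hx.2)
  have hm₂ : StrictAntiOn sasakiEnergy (Set.Icc b₂ b₃) :=
    strictAntiOn_of_deriv_neg (convex_Icc _ _) (hc fun x hx => by linarith [hx.1]) fun x hx => by
      rw [interior_Icc] at hx
      exact hdneg (by linarith [hx.1]) (hs₂ x hx.1 hx.2)
  have hm₃ : StrictMonoOn sasakiEnergy (Set.Ici b₃) :=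
    strictMonoOn_of_deriv_pos (convex_Ici _) (hc fun x (hx : b₃ ≤ x) => by linarith)
      fun x hx => by
      rw [interior_Ici] at hx
      exact hdpos (by linarith [Set.mem_Ioi.1 hx]) (hs₃ x hx)
  have hmin₁ {b : ℝ} (h0 : 0 < b) (h : b ≤ b₂) : sasakiEnergy b₁ ≤ sasakiEnergy b := by
    rcases le_total b b₁ with hb | hb
    · exact hm₀.antitoneOn ⟨h0, hb⟩ ⟨hpos₁, le_rfl⟩ hb
    · exact hm₁.monotoneOn ⟨le_rfl, h₁₂.le⟩ ⟨hb, h⟩ hb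
  have hmin₃ {b : ℝ} (h : b₂ ≤ b) : sasakiEnergy b₃ ≤ sasakiEnergy b := by
    rcases le_total b b₃ with hb | hb
    · exact hm₂.antitoneOn ⟨h, hb⟩ ⟨h₂₃.le, le_rfl⟩ hb
    · exact hm₃.monotoneOn Set.self_mem_Ici hb hb
  have h₃₁ : sasakiEnergy b₃ ≤ sasakiEnergy b₁ := calc
    sasakiEnergy b₃ ≤ sasakiEnergy 31 := hmin₃ (by linarith)
    _ ≤ 250000000 := by norm_num [sasakiEnergy]
    _ ≤ sasakiEnergy b₁ := sasakiEnergy_ge h₁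
  refine ⟨b₁, b₂, b₃, by norm_num at h₁ ⊢; exact h₁, by norm_num at h₂ ⊢; exact h₂, h₃, ?_,
    ?_, ?_, ?_, fun b hb => ?_⟩
  · ext b
    simp only [Set.mem_ofPred_eq, Set.mem_insert_iff, Set.mem_singleton_iff]
    constructor
    · rintro ⟨h0, h⟩
      by_contra! hne
      obtain ⟨n₁, n₂, n₃⟩ := hne
      rcases n₁.lt_or_gt with h' | h'
      · exact (hdneg h0 (hs₀ b h0 h')).ne h
      rcases n₂.lt_or_gt with h'' | h''
      · exact (hdpos h0 (hs₁ b h' h'')).ne' h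
      rcases n₃.lt_or_gt with h' | h'
      · exact (hdneg h0 (hs₂ b h'' h')).ne h
      · exact (hdpos h0 (hs₃ b h')).ne' h
    · rintro (rfl | rfl | rfl)
      · exact ⟨hpos₁, by rw [(hasDerivAt_sasakiEnergy hpos₁).deriv, hb₁, mul_zero]⟩
      · have h0 : 0 < b := by linarith
        exact ⟨h0, by rw [(hasDerivAt_sasakiEnergy h0).deriv, hb₂, mul_zero]⟩
      · have h0 : 0 < b := by linarith
        exact ⟨h0, by rw [(hasDerivAt_sasakiEnergy h0).deriv, hb₃, mul_zero]⟩
  · filter_upwards [Icc_mem_nhds h₁₂ h₂₃] with b hb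
    rcases le_total b b₂ with h | h
    · exact hm₁.monotoneOn ⟨hb.1, h⟩ ⟨h₁₂.le, le_rfl⟩ h
    · exact hm₂.antitoneOn ⟨le_rfl, h₂₃.le⟩ ⟨h, hb.2⟩ h
  · filter_upwards [Ioo_mem_nhds hpos₁ h₁₂] with b hb using hmin₁ hb.1 hb.2.le
  · filter_upwards [Ioi_mem_nhds h₂₃] with b hb using hmin₃ (le_of_lt hb)
  · rcases le_total b b₂ with h | h
    · exact h₃₁.trans (hmin₁ hb h)
    · exact hmin₃ h
end

section
/- Define H(b) = (3b² − 202b + 2)³/(b²(3b+2)²) for b > 0. Then the set {b ∈ (0,∞) : H′(b) = 0} consists of exactly three points: (101−√10195)/3, (101+√10195)/3, and the unique root b₀ ∈ (0,∞) of the cubic 9b³ + 315b² − 214b − 4, which satisfies 0.68 < b₀ < 0.69. Moreover, H attains its global minimum on (0,∞) at b₀. -/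
/-- The derivative of `(3b² − 202b + 2)³/(b²(3b+2)²)` at a positive point, in factored form. -/
theorem hasDerivAt_einsteinHilbert {b : ℝ} (hb : 0 < b) :
    HasDerivAt (fun b : ℝ => (3 * b ^ 2 - 202 * b + 2) ^ 3 / (b ^ 2 * (3 * b + 2) ^ 2))
      (2 * (3 * b ^ 2 - 202 * b + 2) ^ 2 * (9 * b ^ 3 + 315 * b ^ 2 - 214 * b - 4) /
        (b * (3 * b + 2)) ^ 3) b := by
  have hb' : 3 * b + 2 ≠ 0 := by positivity
  have hnum : HasDerivAt (fun b : ℝ => 3 * b ^ 2 - 202 * b + 2) (6 * b - 202) b :=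
    ((((hasDerivAt_pow 2 b).const_mul 3).sub ((hasDerivAt_id b).const_mul 202)).add_const
      2).congr_deriv (by norm_num; ring)
  have hlin : HasDerivAt (fun b : ℝ => 3 * b + 2) 3 b :=
    (((hasDerivAt_id b).const_mul 3).add_const 2).congr_deriv (by norm_num)
  refine ((hnum.fun_pow 3).fun_div ((hasDerivAt_pow 2 b).fun_mul (hlin.fun_pow 2))
    (by positivity)).congr_deriv ?_
  norm_num
  field_simp
  ring

/-- The critical cubic factors through any of its positive roots. -/
theorem cubic_eq_mul_of_root {b₀ : ℝ} (h₀ : 0 < b₀)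
    (hroot : 9 * b₀ ^ 3 + 315 * b₀ ^ 2 - 214 * b₀ - 4 = 0) (b : ℝ) :
    9 * b ^ 3 + 315 * b ^ 2 - 214 * b - 4 =
      (b - b₀) * (9 * b ^ 2 + (315 + 9 * b₀) * b + 4 / b₀) := by
  field_simp
  linear_combination b * hroot

theorem exists_cubic_root :
    ∃ b₀ : ℝ, (0.68 : ℝ) < b₀ ∧ b₀ < 0.69 ∧ 9 * b₀ ^ 3 + 315 * b₀ ^ 2 - 214 * b₀ - 4 = 0 := by
  obtain ⟨b₀, ⟨h₁, h₂⟩, hroot⟩ := intermediate_value_Ioo (by norm_num : (0.68 : ℝ) ≤ 0.69)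
    (f := fun b : ℝ => 9 * b ^ 3 + 315 * b ^ 2 - 214 * b - 4) (by fun_prop)
    (show (0 : ℝ) ∈ _ by constructor <;> norm_num)
  exact ⟨b₀, h₁, h₂, hroot⟩

theorem numerator_eq_zero_iff (b : ℝ) :
    3 * b ^ 2 - 202 * b + 2 = 0 ↔
      b = (101 - Real.sqrt 10195) / 3 ∨ b = (101 + Real.sqrt 10195) / 3 := by
  have hsq : Real.sqrt 10195 ^ 2 = 10195 := Real.sq_sqrt (by norm_num)
  rw [← sub_eq_zero (a := b), ← sub_eq_zero (a := b) (b := (101 + _) / 3), ← mul_eq_zero]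
  constructor <;> intro h
  · linear_combination h / 3 - hsq / 9
  · linear_combination 3 * h + hsq / 3


/-- For `H(b) = (3b² − 202b + 2)³/(b²(3b+2)²)` on `(0,∞)`, the critical set of `H`
in `(0,∞)` is exactly `{(101−√10195)/3, (101+√10195)/3, b₀}` where `b₀` is the unique
positive root of `9b³ + 315b² − 214b − 4`, which satisfies `0.68 < b₀ < 0.69`; moreover
`H` attains its global minimum on `(0,∞)` at `b₀`. -/
theorem stmt_13 (H : ℝ → ℝ)
    (hH : ∀ b, H b = (3 * b ^ 2 - 202 * b + 2) ^ 3 / (b ^ 2 * (3 * b + 2) ^ 2)) :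
    ∃ b₀ : ℝ, 0 < b₀ ∧ 9 * b₀ ^ 3 + 315 * b₀ ^ 2 - 214 * b₀ - 4 = 0 ∧
      (∀ b : ℝ, 0 < b → 9 * b ^ 3 + 315 * b ^ 2 - 214 * b - 4 = 0 → b = b₀) ∧
      (0.68 : ℝ) < b₀ ∧ b₀ < 0.69 ∧
      {b : ℝ | 0 < b ∧ deriv H b = 0}
        = {(101 - Real.sqrt 10195) / 3, (101 + Real.sqrt 10195) / 3, b₀} ∧
      (∀ b : ℝ, 0 < b → H b₀ ≤ H b) := by
  obtain rfl : H = fun b => (3 * b ^ 2 - 202 * b + 2) ^ 3 / (b ^ 2 * (3 * b + 2) ^ 2) :=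
    funext hH
  clear hH
  obtain ⟨b₀, hlo, hhi, hroot⟩ := exists_cubic_root
  have h₀ : 0 < b₀ := by linarith
  have hfac := cubic_eq_mul_of_root h₀ hroot
  have hquad : ∀ b : ℝ, 0 < b → 0 < 9 * b ^ 2 + (315 + 9 * b₀) * b + 4 / b₀ :=
    fun b hb => by positivity
  have huniq : ∀ b : ℝ, 0 < b → 9 * b ^ 3 + 315 * b ^ 2 - 214 * b - 4 = 0 → b = b₀ := by
    intro b hb h
    rw [hfac, mul_eq_zero] at h
    exact sub_eq_zero.mp (h.resolve_right (hquad b hb).ne')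
  refine ⟨b₀, h₀, hroot, huniq, hlo, hhi, ?_, ?_⟩
  · have hsqrt : Real.sqrt 10195 < 101 := (Real.sqrt_lt' (by norm_num)).mpr (by norm_num)
    have hcrit : ∀ b : ℝ, 0 < b →
        (deriv (fun b : ℝ => (3 * b ^ 2 - 202 * b + 2) ^ 3 / (b ^ 2 * (3 * b + 2) ^ 2)) b = 0 ↔
          (b = (101 - Real.sqrt 10195) / 3 ∨ b = (101 + Real.sqrt 10195) / 3) ∨ b = b₀) := by
      intro b hb
      have hden : (b * (3 * b + 2)) ^ 3 ≠ 0 := by positivity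
      rw [(hasDerivAt_einsteinHilbert hb).deriv, div_eq_zero_iff, or_iff_left hden, mul_eq_zero,
        mul_eq_zero, or_iff_right two_ne_zero, sq_eq_zero_iff, numerator_eq_zero_iff]
      exact or_congr_right ⟨huniq b hb, fun h => h ▸ hroot⟩
    ext b
    simp only [Set.mem_ofPred_eq, Set.mem_insert_iff, Set.mem_singleton_iff, ← or_assoc]
    refine ⟨fun h => (hcrit b h.1).mp h.2, fun h => ?_⟩
    have hb : 0 < b := by
      rcases h with (rfl | rfl) | rfl
      · linarith
      · positivity
      · exact h₀
    exact ⟨hb, (hcrit b hb).mpr h⟩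
  · intro b hb
    rcases le_total b b₀ with h | h
    · refine antitoneOn_of_hasDerivWithinAt_nonpos (convex_Icc b b₀)
        (fun x hx => (hasDerivAt_einsteinHilbert
          (hb.trans_le hx.1)).continuousAt.continuousWithinAt)
        (fun x hx => (hasDerivAt_einsteinHilbert
          (hb.trans_le (interior_subset hx).1)).hasDerivWithinAt)
        (fun x hx => ?_) (Set.left_mem_Icc.mpr h) (Set.right_mem_Icc.mpr h) h
      have hx' := interior_subset hx
      have hx₀ : 0 < x := hb.trans_le hx'.1
      rw [hfac]
      exact div_nonpos_of_nonpos_of_nonneg (mul_nonpos_of_nonneg_of_nonpos (by positivity)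
        (mul_nonpos_of_nonpos_of_nonneg (sub_nonpos.mpr hx'.2) (hquad x hx₀).le))
        (by positivity)
    · refine monotoneOn_of_hasDerivWithinAt_nonneg (convex_Icc b₀ b)
        (fun x hx => (hasDerivAt_einsteinHilbert
          (h₀.trans_le hx.1)).continuousAt.continuousWithinAt)
        (fun x hx => (hasDerivAt_einsteinHilbert
          (h₀.trans_le (interior_subset hx).1)).hasDerivWithinAt)
        (fun x hx => ?_) (Set.left_mem_Icc.mpr h) (Set.right_mem_Icc.mpr h) h
      have hx' := interior_subset hx
      have hx₀ : 0 < x := h₀.trans_le hx'.1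
      rw [hfac]
      exact div_nonneg (mul_nonneg (by positivity)
        (mul_nonneg (sub_nonneg.mpr hx'.1) (hquad x hx₀).le)) (by positivity)
end

section
/- Define, for b > 0, H(b) = (3b² + 202b + 2)³/(b²(3b+2)²) and SE(b) = (27b⁵ + 54b⁴ + 63594b³ + 43204b² + 36b + 8)³/(b⁴(3b+2)(9b²+24b+4)³). Then the critical sets coincide and are given by the zero set of the cubic 9b³ − 291b² + 190b − 4: that is, {b ∈ (0,∞) : H′(b) = 0} = {b ∈ (0,∞) : SE′(b) = 0} = {b ∈ (0,∞) : 9b³ − 291b² + 190b − 4 = 0}. -/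
theorem deriv_einsteinHilbert {b : ℝ} (hb : 0 < b) :
    deriv (fun b : ℝ => (3 * b ^ 2 + 202 * b + 2) ^ 3 / (b ^ 2 * (3 * b + 2) ^ 2)) b =
      2 * (3 * b ^ 2 + 202 * b + 2) ^ 2 / (b ^ 3 * (3 * b + 2) ^ 3) *
        (9 * b ^ 3 - 291 * b ^ 2 + 190 * b - 4) := by
  have hl : HasDerivAt (fun b : ℝ => 3 * b + 2) 3 b := by
    simpa using ((hasDerivAt_id b).const_mul 3).add_const 2
  have hp : HasDerivAt (fun b : ℝ => 3 * b ^ 2 + 202 * b + 2) (6 * b + 202) b := by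
    refine ((((hasDerivAt_pow 2 b).const_mul 3).add
      ((hasDerivAt_id b).const_mul 202)).add_const 2).congr_deriv ?_
    norm_num
    ring
  have hl0 : 3 * b + 2 ≠ 0 := by positivity
  refine ((hp.fun_pow 3).fun_div ((hasDerivAt_pow 2 b).fun_mul (hl.fun_pow 2))
    (by positivity)).deriv.trans ?_
  field_simp
  ring

theorem deriv_sasakiEnergy {b : ℝ} (hb : 0 < b) :
    deriv (fun b : ℝ => (27 * b ^ 5 + 54 * b ^ 4 + 63594 * b ^ 3 + 43204 * b ^ 2
        + 36 * b + 8) ^ 3 / (b ^ 4 * (3 * b + 2) * (9 * b ^ 2 + 24 * b + 4) ^ 3)) b =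
      4 * (27 * b ^ 5 + 54 * b ^ 4 + 63594 * b ^ 3 + 43204 * b ^ 2 + 36 * b + 8) ^ 2 *
        (81 * b ^ 5 + 3105 * b ^ 4 + 4158 * b ^ 3 + 2856 * b ^ 2 + 976 * b + 16) /
        (b ^ 5 * (3 * b + 2) ^ 2 * (9 * b ^ 2 + 24 * b + 4) ^ 4) *
        (9 * b ^ 3 - 291 * b ^ 2 + 190 * b - 4) := by
  have hl : HasDerivAt (fun b : ℝ => 3 * b + 2) 3 b := by
    simpa using ((hasDerivAt_id b).const_mul 3).add_const 2
  have hr : HasDerivAt (fun b : ℝ => 9 * b ^ 2 + 24 * b + 4) (18 * b + 24) b := by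
    refine ((((hasDerivAt_pow 2 b).const_mul 9).add
      ((hasDerivAt_id b).const_mul 24)).add_const 4).congr_deriv ?_
    norm_num
    ring
  have hg : HasDerivAt (fun b : ℝ => 27 * b ^ 5 + 54 * b ^ 4 + 63594 * b ^ 3 + 43204 * b ^ 2
      + 36 * b + 8) (135 * b ^ 4 + 216 * b ^ 3 + 190782 * b ^ 2 + 86408 * b + 36) b := by
    refine (((((((hasDerivAt_pow 5 b).const_mul 27).add
      ((hasDerivAt_pow 4 b).const_mul 54)).add ((hasDerivAt_pow 3 b).const_mul 63594)).add
      ((hasDerivAt_pow 2 b).const_mul 43204)).add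
      ((hasDerivAt_id b).const_mul 36)).add_const 8).congr_deriv ?_
    norm_num
    ring
  have hl0 : 3 * b + 2 ≠ 0 := by positivity
  have hr0 : 9 * b ^ 2 + 24 * b + 4 ≠ 0 := by positivity
  refine ((hg.fun_pow 3).fun_div (((hasDerivAt_pow 4 b).fun_mul hl).fun_mul (hr.fun_pow 3))
    (by positivity)).deriv.trans ?_
  field_simp
  ring


/-- For `H(b) = (3b² + 202b + 2)³/(b²(3b+2)²)` and
`SE(b) = (27b⁵ + 54b⁴ + 63594b³ + 43204b² + 36b + 8)³/(b⁴(3b+2)(9b²+24b+4)³)`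
on `(0,∞)`, the critical sets of `H` and `SE` in `(0,∞)` coincide and are both equal to
the positive zero set of the cubic `9b³ − 291b² + 190b − 4`. -/
theorem stmt_18 (H SE : ℝ → ℝ)
    (hH : ∀ b, H b = (3 * b ^ 2 + 202 * b + 2) ^ 3 / (b ^ 2 * (3 * b + 2) ^ 2))
    (hSE : ∀ b, SE b = (27 * b ^ 5 + 54 * b ^ 4 + 63594 * b ^ 3 + 43204 * b ^ 2
        + 36 * b + 8) ^ 3 / (b ^ 4 * (3 * b + 2) * (9 * b ^ 2 + 24 * b + 4) ^ 3)) :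
    {b : ℝ | 0 < b ∧ deriv H b = 0} = {b : ℝ | 0 < b ∧ deriv SE b = 0} ∧
    {b : ℝ | 0 < b ∧ deriv H b = 0}
      = {b : ℝ | 0 < b ∧ 9 * b ^ 3 - 291 * b ^ 2 + 190 * b - 4 = 0} := by
  obtain rfl : H = _ := funext hH
  obtain rfl : SE = _ := funext hSE
  have hH_iff : ∀ b : ℝ, 0 < b → (deriv (fun b : ℝ => (3 * b ^ 2 + 202 * b + 2) ^ 3 /
      (b ^ 2 * (3 * b + 2) ^ 2)) b = 0 ↔ 9 * b ^ 3 - 291 * b ^ 2 + 190 * b - 4 = 0) := by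
    intro b hb
    rw [deriv_einsteinHilbert hb]
    exact mul_eq_zero_iff_left (by positivity)
  have hSE_iff : ∀ b : ℝ, 0 < b → (deriv (fun b : ℝ => (27 * b ^ 5 + 54 * b ^ 4 + 63594 * b ^ 3
      + 43204 * b ^ 2 + 36 * b + 8) ^ 3 / (b ^ 4 * (3 * b + 2) *
      (9 * b ^ 2 + 24 * b + 4) ^ 3)) b = 0 ↔ 9 * b ^ 3 - 291 * b ^ 2 + 190 * b - 4 = 0) := by
    intro b hb
    rw [deriv_sasakiEnergy hb]
    exact mul_eq_zero_iff_left (by positivity)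
  exact ⟨Set.ext fun b => and_congr_right fun hb => (hH_iff b hb).trans (hSE_iff b hb).symm,
    Set.ext fun b => and_congr_right (hH_iff b)⟩
end
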